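/- arXiv:1801.08413 — 5 statements merged into one kernel-verified Lean document; each statement's English description precedes it below -/
import Mathlib

section
/- Fix T > 0 and let U be a nonempty separable metric space equipped with its Borel σ-algebra. If (u_n) is a sequence of Borel-measurable functions from ℝ to U that is Cauchy for the Ekeland distance, i.e. for every ε > 0 there is N such that δ_E(u_n, u_m) < ε for all n, m ≥ N, then there exists a Borel-measurable function u : ℝ → U such that δ_E(u_n, u) → 0 as n → ∞. In other words, the space of (a.e.-equivalence classes of) measurable functions from [0,T] to U endowed with δ_E is complete. -/
open MeasureTheory Set Filter Topology
open scoped ENNReal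

/-- Completeness of the space of measurable controls for the Ekeland distance:
every δ_E-Cauchy sequence of Borel-measurable functions `ℝ → U` (with `U` a nonempty
separable metric space) converges in δ_E to some Borel-measurable function. -/
theorem ekeland_distance_complete (T : ℝ) (hT : 0 < T) (U : Type*) [MetricSpace U]
    [TopologicalSpace.SeparableSpace U] [MeasurableSpace U] [BorelSpace U] [Nonempty U]
    (δE : (ℝ → U) → (ℝ → U) → ℝ≥0∞)
    (hδE : ∀ u v : ℝ → U, δE u v = volume {t ∈ Icc (0 : ℝ) T | u t ≠ v t})
    (un : ℕ → ℝ → U) (hmeas : ∀ n, Measurable (un n))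
    (hcauchy : ∀ ε : ℝ≥0∞, 0 < ε → ∃ N : ℕ, ∀ n m : ℕ, N ≤ n → N ≤ m →
      δE (un n) (un m) < ε) :
    ∃ u : ℝ → U, Measurable u ∧ Tendsto (fun n => δE (un n) u) atTop (𝓝 0) := by
  classical
  have : SecondCountableTopology U := UniformSpace.secondCountable_of_separable U
  obtain ⟨c⟩ := ‹Nonempty U›
  let f : ℕ → ℝ≥0∞ := fun k => (2⁻¹ : ℝ≥0∞) ^ k
  have hfpos : ∀ k, 0 < f k := fun k => ENNReal.pow_pos (by simp) k
  have hfsum : ∑' k, f k ≠ ∞ := by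
    simp only [f, ENNReal.tsum_geometric, ENNReal.one_sub_inv_two, inv_inv]
    exact ENNReal.ofNat_ne_top
  choose N hN using fun k => hcauchy (f k) (hfpos k)
  let φ : ℕ → ℕ := fun k => ∑ i ∈ Finset.range (k + 1), N i
  have hφ : ∀ i j, i ≤ j → N i ≤ φ j := fun i j hij =>
    Finset.single_le_sum (f := N) (fun _ _ => Nat.zero_le _)
      (Finset.mem_range.2 (Nat.lt_succ_of_le hij))
  let A : ℕ → Set ℝ := fun k => {t ∈ Icc (0 : ℝ) T | un (φ k) t ≠ un (φ (k + 1)) t}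
  have hA : ∀ k, volume (A k) ≤ f k := fun k => by
    have := hN k (φ k) (φ (k + 1)) (hφ _ _ le_rfl) (hφ _ _ (Nat.le_succ k))
    rw [hδE] at this
    exact this.le
  have hAm : ∀ k, MeasurableSet (A k) := fun k =>
    measurableSet_Icc.inter (measurableSet_eq_fun (hmeas _) (hmeas _)).compl
  let B : ℕ → Set ℝ := fun k => ⋃ j, A (j + k)
  have hB : ∀ k, volume (B k) ≤ ∑' j, f (j + k) := fun k =>
    (measure_iUnion_le _).trans (ENNReal.tsum_le_tsum fun j => hA _)
  have hBm : ∀ k, MeasurableSet (B k) := fun k => MeasurableSet.iUnion fun j => hAm _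
  have hconst : ∀ k j t, t ∈ Icc (0 : ℝ) T \ B k → un (φ (j + k)) t = un (φ k) t := by
    intro k j t ht
    induction j with
    | zero => simp
    | succ j ih =>
      rw [← ih]
      by_contra h
      refine ht.2 (mem_iUnion.2 ⟨j, ht.1, fun h' => h ?_⟩)
      rw [h', Nat.add_right_comm]
  have hBanti : ∀ k j, k ≤ j → B j ⊆ B k := by
    intro k j hkj t ht
    obtain ⟨i, hi⟩ := mem_iUnion.1 ht
    refine mem_iUnion.2 ⟨i + (j - k), ?_⟩
    rwa [show i + (j - k) + k = i + j by omega]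
  let u : ℝ → U := fun t =>
    if h : ∃ k, t ∈ Icc (0 : ℝ) T \ B k then un (φ (Nat.find h)) t else c
  have hu : ∀ k t, t ∈ Icc (0 : ℝ) T \ B k → u t = un (φ k) t := by
    intro k t ht
    have h : ∃ k, t ∈ Icc (0 : ℝ) T \ B k := ⟨k, ht⟩
    have h1 : u t = un (φ (Nat.find h)) t := dif_pos h
    have h2 := hconst (Nat.find h) (k - Nat.find h) t (Nat.find_spec h)
    rw [Nat.sub_add_cancel (Nat.find_min' h ht)] at h2
    rw [h1, h2]
  let v : ℕ → ℝ → U := fun k => (Icc (0 : ℝ) T \ B k).piecewise (un (φ k)) (fun _ => c)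
  have hv : ∀ k, Measurable (v k) := fun k =>
    (hmeas _).piecewise (measurableSet_Icc.diff (hBm k)) measurable_const
  have hum : Measurable u := by
    refine measurable_of_tendsto_metrizable hv (tendsto_pi_nhds.2 fun t => ?_)
    refine tendsto_const_nhds.congr' ?_
    by_cases h : ∃ k, t ∈ Icc (0 : ℝ) T \ B k
    · obtain ⟨k, hk⟩ := h
      filter_upwards [eventually_ge_atTop k] with j hj
      have hj' : t ∈ Icc (0 : ℝ) T \ B j := ⟨hk.1, fun h => hk.2 (hBanti k j hj h)⟩
      rw [hu j t hj']
      exact (piecewise_eq_of_mem _ _ _ hj').symm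
    · refine Eventually.of_forall fun j => ?_
      have h1 : u t = c := dif_neg h
      rw [h1]
      exact (piecewise_eq_of_notMem (Icc (0 : ℝ) T \ B j) (un (φ j)) (fun _ => c) fun h' => h ⟨j, h'⟩).symm
  refine ⟨u, hum, ?_⟩
  have htail := ENNReal.tendsto_sum_nat_add f hfsum
  have hbound : ∀ n k, δE (un n) u ≤ δE (un n) (un (φ k)) + ∑' j, f (j + k) := by
    intro n k
    rw [hδE, hδE]
    refine (measure_mono ?_).trans ((measure_union_le _ (B k)).trans (add_le_add le_rfl (hB k)))
    intro t ht
    by_cases h : t ∈ B k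
    · exact Or.inr h
    · refine Or.inl ⟨ht.1, ?_⟩
      rw [← hu k t ⟨ht.1, h⟩]
      exact ht.2
  rw [ENNReal.tendsto_atTop_zero]
  intro ε hε
  have hε2 : 0 < ε / 2 := ENNReal.half_pos hε.ne'
  have h1 : ∀ᶠ k in atTop, ∑' j, f (j + k) < ε / 2 := htail.eventually_lt_const hε2
  have h2 : ∀ᶠ k in atTop, f k < ε / 2 :=
    (ENNReal.tendsto_pow_atTop_nhds_zero_of_lt_one (by simp)).eventually_lt_const hε2
  obtain ⟨k, hk1, hk2⟩ := (h1.and h2).exists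
  refine ⟨N k, fun n hn => (hbound n k).trans ?_⟩
  rw [← ENNReal.add_halves ε]
  exact add_le_add ((hN k n (φ k) hn (hφ _ _ le_rfl)).le.trans hk2.le) hk1.le
end

section
/- With F, ℓ_low and ℓ_up as defined in the context, for all z, z̄ : Fin n → ℝ one has the sandwich inequalities Σ_i ℓ_low(i)·(z(i) − z̄(i))·g(i) ≤ F(z) − F(z̄) ≤ Σ_i ℓ_up(i)·(z(i) − z̄(i))·g(i). -/
open Finset

/-- Sandwich inequalities for the infimum-type driver
`F(z) = inf_a ( c(a) + Σ_i ℓ(a)(i)·z(i)·g(i) )`: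
`Σ_i ℓ_low(i)·(z(i) − z̄(i))·g(i) ≤ F(z) − F(z̄) ≤ Σ_i ℓ_up(i)·(z(i) − z̄(i))·g(i)`. -/
theorem driver_sandwich {n : ℕ} (hn : 1 ≤ n) {A : Type*} [Nonempty A]
    (g : Fin n → ℝ) (hg : ∀ i, 0 ≤ g i)
    (c : A → ℝ) (hc : BddBelow (Set.range c))
    (ℓ : A → Fin n → ℝ) (M : ℝ) (hℓ : ∀ a i, |ℓ a i| ≤ M)
    (F : (Fin n → ℝ) → ℝ)
    (hF : ∀ z : Fin n → ℝ, F z = ⨅ a : A, (c a + ∑ i, ℓ a i * z i * g i))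
    (llow lup : (Fin n → ℝ) → (Fin n → ℝ) → Fin n → ℝ)
    (hlow : ∀ z zb : Fin n → ℝ, ∀ i,
      llow z zb i = if zb i < z i then ⨅ a : A, ℓ a i else ⨆ a : A, ℓ a i)
    (hup : ∀ z zb : Fin n → ℝ, ∀ i,
      lup z zb i = if z i < zb i then ⨅ a : A, ℓ a i else ⨆ a : A, ℓ a i) :
    ∀ z zb : Fin n → ℝ,
      (∑ i, llow z zb i * (z i - zb i) * g i) ≤ F z - F zb ∧
      F z - F zb ≤ ∑ i, lup z zb i * (z i - zb i) * g i := by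
  have hbd : ∀ z : Fin n → ℝ, BddBelow (Set.range fun a : A => c a + ∑ i, ℓ a i * z i * g i) := by
    intro z
    obtain ⟨b, hb⟩ := hc
    refine ⟨b + ∑ i, -(M * |z i| * g i), ?_⟩
    rintro _ ⟨a, rfl⟩
    refine add_le_add (hb ⟨a, rfl⟩) (Finset.sum_le_sum fun i _ => ?_)
    have h1 : |ℓ a i * z i| ≤ M * |z i| := by
      rw [abs_mul]
      exact mul_le_mul_of_nonneg_right (hℓ a i) (abs_nonneg _)
    have h2 := mul_le_mul_of_nonneg_right (abs_le.mp h1).1 (hg i)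
    linarith
  have key : ∀ z zb : Fin n → ℝ, (∑ i, llow z zb i * (z i - zb i) * g i) ≤ F z - F zb := by
    intro z zb
    rw [le_sub_iff_add_le, hF z]
    refine le_ciInf fun a => ?_
    have h1 : F zb ≤ c a + ∑ i, ℓ a i * zb i * g i := by
      rw [hF zb]
      exact ciInf_le (hbd zb) a
    have h2 : (∑ i, llow z zb i * (z i - zb i) * g i) ≤ ∑ i, ℓ a i * (z i - zb i) * g i := by
      refine Finset.sum_le_sum fun i _ => mul_le_mul_of_nonneg_right ?_ (hg i)
      rw [hlow]
      split_ifs with h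
      · refine mul_le_mul_of_nonneg_right (ciInf_le ⟨-M, ?_⟩ a) (by linarith)
        rintro _ ⟨b, rfl⟩
        exact (abs_le.mp (hℓ b i)).1
      · refine mul_le_mul_of_nonpos_right (le_ciSup (f := fun a => ℓ a i) ⟨M, ?_⟩ a) (by linarith)
        rintro _ ⟨b, rfl⟩
        exact (abs_le.mp (hℓ b i)).2
    have h3 : ∑ i, ℓ a i * (z i - zb i) * g i
        = ∑ i, ℓ a i * z i * g i - ∑ i, ℓ a i * zb i * g i := by
      rw [← Finset.sum_sub_distrib]
      exact Finset.sum_congr rfl fun i _ => by ring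
    linarith
  intro z zb
  refine ⟨key z zb, ?_⟩
  have h := key zb z
  have h4 : ∑ i, lup z zb i * (z i - zb i) * g i = -∑ i, llow zb z i * (zb i - z i) * g i := by
    rw [← Finset.sum_neg_distrib]
    refine Finset.sum_congr rfl fun i _ => ?_
    rw [hup, hlow]
    ring
  linarith
end

section
/- With F, ℓ_low and ℓ_up as defined in the context, for all z, z̄ : Fin n → ℝ there exists α ∈ [0,1] such that, setting ℓ̂(i) := α·ℓ_up(i) + (1−α)·ℓ_low(i) for each i, one has the exact 'balanced' representation F(z) − F(z̄) = Σ_i ℓ̂(i)·(z(i) − z̄(i))·g(i). -/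
open Finset

/-- Exact balanced representation of the infimum-type driver
`F(z) = inf_a ( c(a) + Σ_i ℓ(a)(i)·z(i)·g(i) )`: for all `z, z̄` there is `α ∈ [0,1]`
such that, with `ℓ̂ := α·ℓ_up + (1−α)·ℓ_low`,
`F(z) − F(z̄) = Σ_i ℓ̂(i)·(z(i) − z̄(i))·g(i)`. -/
theorem driver_balanced {n : ℕ} (hn : 1 ≤ n) {A : Type*} [Nonempty A]
    (g : Fin n → ℝ) (hg : ∀ i, 0 ≤ g i)
    (c : A → ℝ) (hc : BddBelow (Set.range c))
    (ℓ : A → Fin n → ℝ) (M : ℝ) (hℓ : ∀ a i, |ℓ a i| ≤ M)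
    (F : (Fin n → ℝ) → ℝ)
    (hF : ∀ z : Fin n → ℝ, F z = ⨅ a : A, (c a + ∑ i, ℓ a i * z i * g i))
    (llow lup : (Fin n → ℝ) → (Fin n → ℝ) → Fin n → ℝ)
    (hlow : ∀ z zb : Fin n → ℝ, ∀ i,
      llow z zb i = if zb i < z i then ⨅ a : A, ℓ a i else ⨆ a : A, ℓ a i)
    (hup : ∀ z zb : Fin n → ℝ, ∀ i,
      lup z zb i = if z i < zb i then ⨅ a : A, ℓ a i else ⨆ a : A, ℓ a i) :
    ∀ z zb : Fin n → ℝ, ∃ α : ℝ, α ∈ Set.Icc (0 : ℝ) 1 ∧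
      F z - F zb
        = ∑ i, (α * lup z zb i + (1 - α) * llow z zb i) * (z i - zb i) * g i := by
  intro z zb
  have hbb : ∀ i, BddBelow (Set.range fun a => ℓ a i) := fun i =>
    ⟨-M, by rintro _ ⟨a, rfl⟩; exact (abs_le.mp (hℓ a i)).1⟩
  have hba : ∀ i, BddAbove (Set.range fun a => ℓ a i) := fun i =>
    ⟨M, by rintro _ ⟨a, rfl⟩; exact (abs_le.mp (hℓ a i)).2⟩
  have hinf : ∀ a i, (⨅ a : A, ℓ a i) ≤ ℓ a i := fun a i => ciInf_le (hbb i) a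
  have hsup : ∀ a i, ℓ a i ≤ ⨆ a : A, ℓ a i := fun a i => le_ciSup (hba i) a
  have hbd : ∀ w : Fin n → ℝ,
      BddBelow (Set.range fun a => c a + ∑ i, ℓ a i * w i * g i) := by
    intro w
    obtain ⟨m, hm⟩ := hc
    refine ⟨m + ∑ i, -(M * |w i| * g i), ?_⟩
    rintro _ ⟨a, rfl⟩
    refine add_le_add (hm ⟨a, rfl⟩) (Finset.sum_le_sum fun i _ => ?_)
    have h1 : |ℓ a i * w i| ≤ M * |w i| := by
      rw [abs_mul]; exact mul_le_mul_of_nonneg_right (hℓ a i) (abs_nonneg _)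
    have h2 := mul_le_mul_of_nonneg_right (abs_le.mp h1).1 (hg i)
    linarith
  have hFle : ∀ w a, F w ≤ c a + ∑ i, ℓ a i * w i * g i := fun w a => by
    rw [hF]; exact ciInf_le (hbd w) a
  have hL : ∀ a, ∑ i, llow z zb i * (z i - zb i) * g i ≤
      ∑ i, ℓ a i * z i * g i - ∑ i, ℓ a i * zb i * g i := by
    intro a
    rw [← Finset.sum_sub_distrib]
    refine Finset.sum_le_sum fun i _ => ?_
    have : llow z zb i * (z i - zb i) ≤ ℓ a i * (z i - zb i) := by
      rw [hlow]
      split_ifs with h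
      · exact mul_le_mul_of_nonneg_right (hinf a i) (by linarith)
      · exact mul_le_mul_of_nonpos_right (hsup a i) (by linarith)
    have := mul_le_mul_of_nonneg_right this (hg i)
    linarith
  have hU : ∀ a, ∑ i, ℓ a i * z i * g i - ∑ i, ℓ a i * zb i * g i ≤
      ∑ i, lup z zb i * (z i - zb i) * g i := by
    intro a
    rw [← Finset.sum_sub_distrib]
    refine Finset.sum_le_sum fun i _ => ?_
    have : ℓ a i * (z i - zb i) ≤ lup z zb i * (z i - zb i) := by
      rw [hup]
      split_ifs with h
      · exact mul_le_mul_of_nonpos_right (hinf a i) (by linarith)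
      · exact mul_le_mul_of_nonneg_right (hsup a i) (by linarith)
    have := mul_le_mul_of_nonneg_right this (hg i)
    linarith
  have hsum : ∀ α : ℝ, ∑ i, (α * lup z zb i + (1 - α) * llow z zb i) * (z i - zb i) * g i
      = α * ∑ i, lup z zb i * (z i - zb i) * g i
        + (1 - α) * ∑ i, llow z zb i * (z i - zb i) * g i := by
    intro α
    rw [Finset.mul_sum, Finset.mul_sum, ← Finset.sum_add_distrib]
    exact Finset.sum_congr rfl fun i _ => by ring
  simp only [hsum]
  generalize (∑ i, lup z zb i * (z i - zb i) * g i) = U at *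
  generalize (∑ i, llow z zb i * (z i - zb i) * g i) = L at *
  have h1 : F zb + L ≤ F z := by
    rw [hF z]
    exact le_ciInf fun a => by linarith [hFle zb a, hL a]
  have h2 : F z - U ≤ F zb := by
    rw [hF zb]
    exact le_ciInf fun a => by linarith [hFle z a, hU a]
  rcases eq_or_lt_of_le (show L ≤ U by linarith) with h | h
  · exact ⟨0, by simp, by linarith⟩
  · have hp : 0 < U - L := by linarith
    refine ⟨(F z - F zb - L) / (U - L), ⟨div_nonneg (by linarith) hp.le, ?_⟩, ?_⟩
    · rw [div_le_one hp]; linarith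
    · have := div_mul_cancel₀ (F z - F zb - L) hp.ne'
      linarith
end

section
/- With F, β_low and β_up as defined in the context, for all z, z̄ : Fin n → ℝ one has Σ_i β_low(i)·(z(i) − z̄(i))·g(i) ≤ F(z) − F(z̄) ≤ Σ_i β_up(i)·(z(i) − z̄(i))·g(i); consequently there exists ρ ∈ [0,1] such that, with β̂(i) := ρ·β_up(i) + (1−ρ)·β_low(i), one has F(z) − F(z̄) = Σ_i β̂(i)·(z(i) − z̄(i))·g(i). In other words, the sup-inf (lower value) driver F is balanced. -/
open Finset

/-- The sup-inf (lower value) driver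
`F(z) = sup_b inf_a ( c(a)(b) + Σ_i ℓ(a)(b)(i)·z(i)·g(i) )` is balanced:
it satisfies the sandwich inequalities with `β_low`, `β_up`, and hence admits an
exact representation with a convex combination `β̂ = ρ·β_up + (1−ρ)·β_low`. -/
theorem supinf_driver_balanced {n : ℕ} (hn : 1 ≤ n) {A B : Type*} [Nonempty A] [Nonempty B]
    (g : Fin n → ℝ) (hg : ∀ i, 0 ≤ g i)
    (c : A → B → ℝ) (ℓ : A → B → Fin n → ℝ) (M : ℝ)
    (hc : ∀ a b, |c a b| ≤ M) (hℓ : ∀ a b i, |ℓ a b i| ≤ M)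
    (F : (Fin n → ℝ) → ℝ)
    (hF : ∀ z : Fin n → ℝ, F z = ⨆ b : B, ⨅ a : A, (c a b + ∑ i, ℓ a b i * z i * g i))
    (βlow βup : (Fin n → ℝ) → (Fin n → ℝ) → Fin n → ℝ)
    (hβup : ∀ z zb : Fin n → ℝ, ∀ i,
      βup z zb i = if zb i < z i then ⨆ a : A, ⨆ b : B, ℓ a b i
        else ⨅ a : A, ⨅ b : B, ℓ a b i)
    (hβlow : ∀ z zb : Fin n → ℝ, ∀ i,
      βlow z zb i = if z i < zb i then ⨆ a : A, ⨆ b : B, ℓ a b i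
        else ⨅ a : A, ⨅ b : B, ℓ a b i) :
    ∀ z zb : Fin n → ℝ,
      ((∑ i, βlow z zb i * (z i - zb i) * g i) ≤ F z - F zb ∧
        F z - F zb ≤ ∑ i, βup z zb i * (z i - zb i) * g i) ∧
      ∃ ρ : ℝ, ρ ∈ Set.Icc (0 : ℝ) 1 ∧
        F z - F zb
          = ∑ i, (ρ * βup z zb i + (1 - ρ) * βlow z zb i) * (z i - zb i) * g i := by
  have hb : ∀ (z : Fin n → ℝ) a b, |c a b + ∑ i, ℓ a b i * z i * g i|
      ≤ M + ∑ i, M * |z i| * g i := by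
    intro z a b
    refine (abs_add_le _ _).trans (add_le_add (hc a b) ?_)
    refine (Finset.abs_sum_le_sum_abs _ _).trans (Finset.sum_le_sum fun i _ => ?_)
    rw [abs_mul, abs_mul, abs_of_nonneg (hg i)]
    exact mul_le_mul_of_nonneg_right
      (mul_le_mul_of_nonneg_right (hℓ a b i) (abs_nonneg _)) (hg i)
  have hbelow : ∀ (z : Fin n → ℝ) b,
      BddBelow (Set.range fun a => c a b + ∑ i, ℓ a b i * z i * g i) := by
    intro z b
    refine ⟨-(M + ∑ i, M * |z i| * g i), ?_⟩
    rintro _ ⟨a, rfl⟩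
    exact (abs_le.1 (hb z a b)).1
  have habove : ∀ (z : Fin n → ℝ),
      BddAbove (Set.range fun b => ⨅ a, (c a b + ∑ i, ℓ a b i * z i * g i)) := by
    intro z
    refine ⟨M + ∑ i, M * |z i| * g i, ?_⟩
    rintro _ ⟨b, rfl⟩
    obtain ⟨a⟩ := ‹Nonempty A›
    exact (ciInf_le (hbelow z b) a).trans (abs_le.1 (hb z a b)).2
  have hsup : ∀ a b i, ℓ a b i ≤ ⨆ a : A, ⨆ b : B, ℓ a b i := by
    intro a b i
    have h1 : ∀ a, BddAbove (Set.range fun b => ℓ a b i) := fun a =>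
      ⟨M, by rintro _ ⟨b, rfl⟩; exact (abs_le.1 (hℓ a b i)).2⟩
    have h2 : BddAbove (Set.range fun a => ⨆ b, ℓ a b i) :=
      ⟨M, by rintro _ ⟨a, rfl⟩; exact ciSup_le fun b => (abs_le.1 (hℓ a b i)).2⟩
    exact (le_ciSup (h1 a) b).trans (le_ciSup h2 a)
  have hinf : ∀ a b i, (⨅ a : A, ⨅ b : B, ℓ a b i) ≤ ℓ a b i := by
    intro a b i
    have h1 : ∀ a, BddBelow (Set.range fun b => ℓ a b i) := fun a =>
      ⟨-M, by rintro _ ⟨b, rfl⟩; exact (abs_le.1 (hℓ a b i)).1⟩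
    have h2 : BddBelow (Set.range fun a => ⨅ b, ℓ a b i) :=
      ⟨-M, by rintro _ ⟨a, rfl⟩; exact le_ciInf fun b => (abs_le.1 (hℓ a b i)).1⟩
    exact (ciInf_le h2 a).trans (ciInf_le (h1 a) b)
  have hU : ∀ z zb : Fin n → ℝ, F z - F zb ≤ ∑ i, βup z zb i * (z i - zb i) * g i := by
    intro z zb
    rw [sub_le_iff_le_add, hF z, hF zb]
    refine ciSup_le fun b => ?_
    refine le_trans ?_ (add_le_add_right (le_ciSup (habove zb) b) _)
    rw [← sub_le_iff_le_add']
    refine le_ciInf fun a => ?_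
    rw [sub_le_iff_le_add']
    refine (ciInf_le (hbelow z b) a).trans ?_
    have : ∑ i, ℓ a b i * z i * g i
        ≤ ∑ i, βup z zb i * (z i - zb i) * g i + ∑ i, ℓ a b i * zb i * g i := by
      rw [← Finset.sum_add_distrib]
      refine Finset.sum_le_sum fun i _ => ?_
      have key : ℓ a b i * (z i - zb i) ≤ βup z zb i * (z i - zb i) := by
        rw [hβup]
        split_ifs with h
        · exact mul_le_mul_of_nonneg_right (hsup a b i) (by linarith)
        · exact mul_le_mul_of_nonpos_right (hinf a b i) (by linarith)
      have := mul_le_mul_of_nonneg_right key (hg i)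
      linarith
    linarith
  intro z zb
  have hL : (∑ i, βlow z zb i * (z i - zb i) * g i) ≤ F z - F zb := by
    have h := hU zb z
    have e : ∑ i, βlow z zb i * (z i - zb i) * g i
        = -∑ i, βup zb z i * (zb i - z i) * g i := by
      rw [← Finset.sum_neg_distrib]
      refine Finset.sum_congr rfl fun i _ => ?_
      rw [hβlow, hβup]
      ring
    linarith
  have hUz := hU z zb
  refine ⟨⟨hL, hUz⟩, ?_⟩
  have hsum : ∀ ρ : ℝ, ∑ i, (ρ * βup z zb i + (1 - ρ) * βlow z zb i) * (z i - zb i) * g i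
      = ρ * (∑ i, βup z zb i * (z i - zb i) * g i)
        + (1 - ρ) * ∑ i, βlow z zb i * (z i - zb i) * g i := by
    intro ρ
    rw [Finset.mul_sum, Finset.mul_sum, ← Finset.sum_add_distrib]
    exact Finset.sum_congr rfl fun i _ => by ring
  simp only [hsum]
  generalize (∑ i, βup z zb i * (z i - zb i) * g i) = U at *
  generalize (∑ i, βlow z zb i * (z i - zb i) * g i) = L at *
  generalize F z - F zb = x at *
  rcases (hL.trans hUz).eq_or_lt with h | h
  · exact ⟨0, by simp, by linarith⟩
  · have hp : 0 < U - L := by linarith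
    refine ⟨(x - L) / (U - L), ⟨div_nonneg (by linarith) hp.le,
      (div_le_one hp).2 (by linarith)⟩, ?_⟩
    have := hp.ne'
    field_simp
    ring
end

section
/- Let (E, ℰ, μ) be a σ-finite measure space, let 𝒰 be a nonempty set, let n ≥ 1, and let H : E → (Fin n → ℝ) → 𝒰 → ℝ be such that: (i) for every z : Fin n → ℝ and u ∈ 𝒰, the map e ↦ H(e)(z)(u) is measurable; (ii) there is a constant M with |H(e)(0)(u)| ≤ M for all e, u; and (iii) there is a measurable function κ : E → [0,∞) such that |H(e)(z)(u) − H(e)(z')(u)| ≤ κ(e)·‖z − z'‖ for all e, u and all z, z' : Fin n → ℝ. Then there exists a jointly measurable function H* : E × (Fin n → ℝ) → ℝ, continuous in its second argument for each fixed e, such that for every z : Fin n → ℝ, H*(·, z) is an essential infimum of the family (H(·)(z)(u))_{u ∈ 𝒰}: H*(e, z) ≤ H(e)(z)(u) for μ-almost every e, for each u ∈ 𝒰, and every measurable g : E → ℝ with g ≤ H(·)(z)(u) μ-a.e. for all u ∈ 𝒰 satisfies g ≤ H*(·, z) μ-a.e. -/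
open MeasureTheory

theorem countable_cover_aux {E : Type*} [MeasurableSpace E] (μ : Measure E)
    [SigmaFinite μ] {U : Type*} (A : U → Set E) (hA : ∀ u, MeasurableSet (A u)) :
    ∃ C : Set U, C.Countable ∧ ∀ u, ∀ᵐ e ∂μ, e ∈ A u → ∃ v ∈ C, e ∈ A v := by
  let ν := μ.toFinite
  let R : Set ENNReal := {x | ∃ C : Set U, C.Countable ∧ x = ν (⋃ v ∈ C, A v)}
  have hne : R.Nonempty := ⟨_, ∅, Set.countable_empty, rfl⟩
  obtain ⟨s, -, hs, hsR⟩ := exists_seq_tendsto_sSup hne (OrderTop.bddAbove R)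
  choose C hC hCs using hsR
  have hCc : (⋃ k, C k).Countable := Set.countable_iUnion hC
  refine ⟨⋃ k, C k, hCc, fun u => ?_⟩
  set B := ⋃ v ∈ ⋃ k, C k, A v with hB
  have hBm : MeasurableSet B := MeasurableSet.biUnion hCc fun v _ => hA v
  have h1 : sSup R ≤ ν B := by
    refine le_of_tendsto' hs fun k => ?_
    rw [hCs k]
    exact measure_mono (Set.biUnion_subset_biUnion_left (Set.subset_iUnion C k))
  have h2 : ν (A u ∪ B) ≤ sSup R := by
    refine le_sSup ⟨insert u (⋃ k, C k), hCc.insert u, ?_⟩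
    rw [Set.biUnion_insert]
  have h3 : ν (A u \ B) = 0 := by
    have h4 : ν (A u ∪ B) = ν (A u \ B) + ν B := by
      rw [← Set.sdiff_union_self, measure_union Set.disjoint_sdiff_left hBm]
    have h5 : ν (A u \ B) + ν B ≤ 0 + ν B := by
      rw [← h4, zero_add]; exact h2.trans h1
    exact le_antisymm ((ENNReal.add_le_add_iff_right (measure_ne_top ν B)).1 h5) zero_le
  have h6 : μ (A u \ B) = 0 := absolutelyContinuous_toFinite μ h3
  filter_upwards [measure_eq_zero_iff_ae_notMem.1 h6] with e he hu
  by_contra hcon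
  refine he ⟨hu, fun hb => hcon ?_⟩
  simpa only [hB, Set.mem_iUnion₂, exists_prop] using hb

/-- Existence of a jointly measurable version of the minimized Hamiltonian
`H*(e, z) = ess inf_{u ∈ 𝒰} H(e, z, u)`, continuous in `z`, for a Hamiltonian that is
measurable in `e`, bounded at `z = 0`, and Lipschitz in `z` with a measurable random
Lipschitz coefficient `κ`. -/
theorem minimized_hamiltonian_exists {E : Type*} [MeasurableSpace E] (μ : Measure E)
    [SigmaFinite μ] {𝒰 : Type*} [Nonempty 𝒰] {n : ℕ} (hn : 1 ≤ n)
    (H : E → (Fin n → ℝ) → 𝒰 → ℝ)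
    (hmeas : ∀ (z : Fin n → ℝ) (u : 𝒰), Measurable fun e => H e z u)
    (M : ℝ) (hM : ∀ e u, |H e 0 u| ≤ M)
    (κ : E → ℝ) (hκmeas : Measurable κ) (hκnonneg : ∀ e, 0 ≤ κ e)
    (hlip : ∀ e u, ∀ z z' : Fin n → ℝ, |H e z u - H e z' u| ≤ κ e * ‖z - z'‖) :
    ∃ Hstar : E × (Fin n → ℝ) → ℝ,
      Measurable Hstar ∧
      (∀ e : E, Continuous fun z : Fin n → ℝ => Hstar (e, z)) ∧
      ∀ z : Fin n → ℝ,
        (∀ u : 𝒰, ∀ᵐ e ∂μ, Hstar (e, z) ≤ H e z u) ∧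
        (∀ g : E → ℝ, Measurable g → (∀ u : 𝒰, ∀ᵐ e ∂μ, g e ≤ H e z u) →
          ∀ᵐ e ∂μ, g e ≤ Hstar (e, z)) := by
  obtain ⟨u₀⟩ := ‹Nonempty 𝒰›
  obtain ⟨D, hDc, hDd⟩ := TopologicalSpace.exists_countable_dense (Fin n → ℝ)
  have : Countable D := hDc.to_subtype
  choose C hC hCu using fun p : D × ℚ =>
    countable_cover_aux μ (fun u => {e | H e p.1 u < (p.2 : ℝ)})
      (fun u => measurableSet_lt (hmeas p.1 u) measurable_const)
  let K : Set 𝒰 := insert u₀ (⋃ p, C p)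
  have hK : K.Countable := (Set.countable_iUnion hC).insert u₀
  have : Countable K := hK.to_subtype
  have : Nonempty K := ⟨⟨u₀, Set.mem_insert _ _⟩⟩
  have hbdd : ∀ e z, BddBelow (Set.range fun v : K => H e z v) := by
    intro e z
    refine ⟨-M - κ e * ‖z‖, ?_⟩
    rintro _ ⟨v, rfl⟩
    have h1 := abs_le.1 (hM e v)
    have h2 := abs_le.1 (hlip e v z 0)
    rw [sub_zero] at h2
    dsimp only
    linarith [h1.1, h2.1]
  let F : E → (Fin n → ℝ) → ℝ := fun e z => ⨅ v : K, H e z v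
  have hFle : ∀ e z z', F e z - F e z' ≤ κ e * ‖z - z'‖ := by
    intro e z z'
    have : F e z - κ e * ‖z - z'‖ ≤ F e z' := by
      refine le_ciInf fun v => ?_
      have h1 : F e z ≤ H e z v := ciInf_le (hbdd e z) v
      have h2 := abs_le.1 (hlip e v z z')
      linarith [h2.2]
    linarith
  have hcontL : ∀ (e : E) (f : (Fin n → ℝ) → ℝ),
      (∀ z z', f z - f z' ≤ κ e * ‖z - z'‖) → Continuous f := by
    intro e f hf
    refine (LipschitzWith.of_dist_le_mul (K := ⟨κ e, hκnonneg e⟩) fun z z' => ?_).continuous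
    rw [Real.dist_eq, dist_eq_norm, abs_le]
    have h1 := hf z z'
    have h2 := hf z' z
    rw [norm_sub_rev] at h2
    change -(κ e * _) ≤ _ ∧ _ ≤ κ e * _
    constructor <;> linarith
  have hFc : ∀ e, Continuous (F e) := fun e => hcontL e _ (hFle e)
  have hHc : ∀ e u, Continuous fun z => H e z u := fun e u =>
    hcontL e _ fun z z' => (abs_le.1 (hlip e u z z')).2
  have hFm : ∀ z, Measurable fun e => F e z := fun z =>
    Measurable.iInf fun v : K => hmeas z v
  refine ⟨fun p => F p.1 p.2, ?_, hFc, fun z => ⟨fun u => ?_, fun g _ hg => ?_⟩⟩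
  · have := measurable_uncurry_of_continuous_of_measurable
      (u := fun z e => F e z) hFc hFm
    exact this.comp measurable_swap
  · have hall : ∀ᵐ e ∂μ, ∀ p : D × ℚ, H e p.1 u < (p.2 : ℝ) →
        ∃ v ∈ C p, H e p.1 v < (p.2 : ℝ) := ae_all_iff.2 fun p => hCu p u
    filter_upwards [hall] with e he
    have hcl : IsClosed {z | F e z ≤ H e z u} := isClosed_le (hFc e) (hHc e u)
    have hsub : D ⊆ {z | F e z ≤ H e z u} := by
      intro q hq
      by_contra hcon
      obtain ⟨r, hr1, hr2⟩ := exists_rat_btwn (lt_of_not_ge (show ¬ F e q ≤ H e q u from hcon))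
      obtain ⟨v, hv, hvr⟩ := he (⟨q, hq⟩, r) hr1
      have h1 : F e q ≤ H e q v :=
        ciInf_le (hbdd e q) (⟨v, Set.mem_insert_of_mem _ (Set.mem_iUnion.2 ⟨_, hv⟩)⟩ : K)
      exact absurd (hr2.trans_le h1) (not_lt.2 hvr.le)
    exact hcl.closure_subset_iff.2 hsub (hDd z)
  · have hall : ∀ᵐ e ∂μ, ∀ v : K, g e ≤ H e z v := ae_all_iff.2 fun v => hg v
    filter_upwards [hall] with e he
    exact le_ciInf he
end
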